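/- The map D ↦ JD is a linear bijection between the set of derivations of the Heisenberg Lie algebra h_n acting trivially on the center (restricted to v) and the set of symmetric linear maps on R^{2n} with respect to the canonical inner product. -/

import Mathlib

open Matrix

/-- The standard symplectic matrix on `ℝ^{2n}`. -/
noncomputable def Jmat (n : ℕ) : Matrix (Fin n ⊕ Fin n) (Fin n ⊕ Fin n) ℝ :=
  Matrix.fromBlocks 0 (-1) 1 0

/-- `D : v → v` is (the restriction to `v` of) a derivation of the Heisenberg Lie
algebra `h_n` acting trivially on the center: `(JDu, w) = -(Ju, Dw)` for `u,w ∈ v`. -/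
def IsHeisDeriv (n : ℕ) (D : Matrix (Fin n ⊕ Fin n) (Fin n ⊕ Fin n) ℝ) : Prop :=
  ∀ u w : Fin n ⊕ Fin n → ℝ,
    (Jmat n).mulVec (D.mulVec u) ⬝ᵥ w = -((Jmat n).mulVec u ⬝ᵥ D.mulVec w)

theorem Jmat_transpose_aux (n : ℕ) : (Jmat n)ᵀ = -Jmat n := by
  simp [Jmat, Matrix.fromBlocks_transpose, Matrix.fromBlocks_neg]

theorem Jmat_sq_aux (n : ℕ) : Jmat n * Jmat n = -1 := by
  rw [← Matrix.fromBlocks_one, Matrix.fromBlocks_neg]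
  simp [Jmat, Matrix.fromBlocks_multiply]

theorem isHeisDeriv_iff_aux (n : ℕ) (D : Matrix (Fin n ⊕ Fin n) (Fin n ⊕ Fin n) ℝ) :
    IsHeisDeriv n D ↔ (Jmat n * D)ᵀ = Jmat n * D := by
  have h1 : ∀ u w : Fin n ⊕ Fin n → ℝ,
      (Jmat n).mulVec (D.mulVec u) ⬝ᵥ w = u ⬝ᵥ ((Jmat n * D)ᵀ).mulVec w := by
    intro u w
    rw [Matrix.mulVec_mulVec, Matrix.dotProduct_mulVec, Matrix.vecMul_transpose]
  have h2 : ∀ u w : Fin n ⊕ Fin n → ℝ,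
      -((Jmat n).mulVec u ⬝ᵥ D.mulVec w) = u ⬝ᵥ (Jmat n * D).mulVec w := by
    intro u w
    rw [← Matrix.mulVec_mulVec, Matrix.dotProduct_mulVec u, ← Matrix.mulVec_transpose,
      Jmat_transpose_aux, Matrix.neg_mulVec, neg_dotProduct]
  unfold IsHeisDeriv
  simp only [h1, h2]
  constructor
  · intro h
    ext i j
    have := h (Pi.single i 1) (Pi.single j 1)
    simpa [-Matrix.transpose_apply, Matrix.transpose_mul] using this
  · intro h u w
    rw [h]

/-- `D ↦ JD` is a linear bijection from the derivations of `h_n` acting trivially on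
the center onto the symmetric linear maps of `ℝ^{2n}`. -/
theorem stmt_2 (n : ℕ) :
    (∀ (c : ℝ) (D D' : Matrix (Fin n ⊕ Fin n) (Fin n ⊕ Fin n) ℝ),
        Jmat n * (c • D + D') = c • (Jmat n * D) + Jmat n * D') ∧
    Set.BijOn (fun D => Jmat n * D)
      {D : Matrix (Fin n ⊕ Fin n) (Fin n ⊕ Fin n) ℝ | IsHeisDeriv n D}
      {A : Matrix (Fin n ⊕ Fin n) (Fin n ⊕ Fin n) ℝ | Aᵀ = A} := by
  refine ⟨fun c D D' => by rw [Matrix.mul_add, Matrix.mul_smul], ?_, ?_, ?_⟩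
  · intro D hD
    exact (isHeisDeriv_iff_aux n D).1 hD
  · intro D _ D' _ h
    have h' : Jmat n * D = Jmat n * D' := h
    have := congrArg (fun M => Jmat n * M) h'
    simpa [← Matrix.mul_assoc, Jmat_sq_aux] using this
  · intro A hA
    have hJ : Jmat n * (-(Jmat n * A)) = A := by
      rw [Matrix.mul_neg, ← Matrix.mul_assoc, Jmat_sq_aux]; simp
    refine ⟨-(Jmat n * A), ?_, hJ⟩
    refine (isHeisDeriv_iff_aux n _).2 ?_
    rw [hJ]
    exact hA
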